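/- Two pairs of binary cubics (f_1, f_2) and (g_1, g_2) over an algebraically closed field k of characteristic ≠ 2,3, with R(f_1,f_2)·D(f_1,f_2) ≠ 0 and R(g_1,g_2)·D(g_1,g_2) ≠ 0, are conjugate under GL_2(k) × Γ if and only if there exists r ≠ 0 in k such that H(f_1,f_2) = r^2 H(g_1,g_2), I(f_1,f_2) = r^4 I(g_1,g_2), R(f_1,f_2) = r^6 R(g_1,g_2), and D(f_1,f_2) = r^8 D(g_1,g_2). -/

import Mathlib

open MvPolynomial
noncomputable section

/-- The binary form of degree `d` with coefficient vector `a`. -/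
def toForm (k : Type*) [CommSemiring k] (d : ℕ) (a : Fin (d+1) → k) :
    MvPolynomial (Fin 2) k :=
  ∑ i : Fin (d+1), C (a i) * X 0 ^ (d - (i : ℕ)) * X 1 ^ (i : ℕ)

/-- Coordinate change by the matrix `g` : `X ↦ g00 X + g01 Y`, `Y ↦ g10 X + g11 Y`. -/
def matAct (k : Type*) [CommSemiring k] (g : Matrix (Fin 2) (Fin 2) k)
    (p : MvPolynomial (Fin 2) k) : MvPolynomial (Fin 2) k :=
  aeval (fun j : Fin 2 => C (g j 0) * X 0 + C (g j 1) * X 1) p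

/-- The coefficient of `X^(d-i) Y^i` in a binary form of degree `d`. -/
def formCoeff (k : Type*) [CommSemiring k] (d : ℕ) (p : MvPolynomial (Fin 2) k)
    (i : Fin (d+1)) : k :=
  coeff (Finsupp.single 0 (d - (i : ℕ)) + Finsupp.single 1 (i : ℕ)) p

/-- The induced action of a `2×2` matrix on the coefficient vector of a binary form. -/
def actCoeff (k : Type*) [CommSemiring k] (d : ℕ) (g : Matrix (Fin 2) (Fin 2) k)
    (a : Fin (d+1) → k) : Fin (d+1) → k :=
  formCoeff k d (matAct k g (toForm k d a))

/-- `P ∈ k[A_0,…,A_d]` is an `SL₂(k)`-invariant. -/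
def SL2Invariant (k : Type*) [CommRing k] (d : ℕ)
    (P : MvPolynomial (Fin (d+1)) k) : Prop :=
  ∀ g : Matrix.SpecialLinearGroup (Fin 2) k, ∀ a : Fin (d+1) → k,
    eval (actCoeff k d (g : Matrix (Fin 2) (Fin 2) k) a) P = eval a P

/-- The ring `R_d` of `SL₂(k)`-invariants in `k[A_0,…,A_d]`. -/
def Rd (k : Type*) [Field k] (d : ℕ) : Subalgebra k (MvPolynomial (Fin (d+1)) k) where
  carrier := {P | SL2Invariant k d P}
  mul_mem' := fun hP hQ g a => by simp only [map_mul]; rw [hP g a, hQ g a]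
  add_mem' := fun hP hQ g a => by simp only [map_add]; rw [hP g a, hQ g a]
  algebraMap_mem' := fun r g a => by simp [SL2Invariant]
/-- The skew-symmetric `SL₂`-invariant pairing `H` on pairs of binary cubics. -/
def Hc {A : Type*} [CommRing A] (a b : Fin 4 → A) : A :=
  3 * a 0 * b 3 - a 1 * b 2 + a 2 * b 1 - 3 * a 3 * b 0

/-- The discriminant of a binary cubic. -/
def discCubic {A : Type*} [CommRing A] (a : Fin 4 → A) : A :=
  -27 * a 0^2 * a 3^2 + 18 * a 0 * a 3 * a 2 * a 1 + a 1^2 * a 2^2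
    - 4 * a 1^3 * a 3 - 4 * a 2^3 * a 0

/-- `D = D_f D_g`, the product of the discriminants of the two cubics. -/
def Dc {A : Type*} [CommRing A] (a b : Fin 4 → A) : A :=
  discCubic a * discCubic b

/-- The resultant `R` of two binary cubics. -/
def Rc {A : Type*} [CommRing A] (a b : Fin 4 → A) : A :=
  3*b 0^2*a 0*b 3*a 3^2 - b 0^3*a 3^3 + 2*b 0^2*a 3^2*b 2*a 1 - b 2^2*b 0*a 1^2*a 3
  - a 0^2*b 2^3*a 3 + b 0^2*a 2*b 1*a 3^2 - b 0^2*a 2^2*b 2*a 3 - b 1^2*b 0*a 1*a 3^2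
  + a 0*b 1^3*a 3^2 - 3*b 0*a 0^2*b 3^2*a 3 - b 0*a 1^3*b 3^2 + a 0^3*b 3^3
  + b 0^2*a 2^3*b 3 - b 0*a 0*b 3*b 2*a 1*a 3 + 3*a 0^2*b 3*b 2*b 1*a 3
  + b 0*a 3*b 3*a 0*b 1*a 2 + 3*b 0*a 0*b 3^2*a 1*a 2 - 2*a 0^2*b 3^2*b 1*a 2
  - 3*b 0*a 3^2*b 2*a 0*b 1 - 3*b 0^2*a 3*b 3*a 1*a 2 - b 2*a 1*a 0^2*b 3^2
  + b 2^2*a 1*a 0*b 1*a 3 + b 2*b 0*a 1^2*b 3*a 2 - b 2*a 1*b 3*a 0*b 1*a 2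
  + a 0^2*b 2^2*a 2*b 3 + 2*b 0*a 0*b 2^2*a 2*a 3 - 2*b 0*a 0*b 2*b 3*a 2^2
  - 2*b 1^2*a 1*a 3*a 0*b 3 + b 1*a 1^2*b 3^2*a 0 + 2*b 1*b 0*a 1^2*b 3*a 3
  + b 1*b 0*a 1*b 2*a 2*a 3 - b 1*b 0*a 1*b 3*a 2^2 - a 0*b 1^2*b 2*a 2*a 3
  + a 0*b 1^2*b 3*a 2^2

/-- The quadratic invariant `I = I₂(fg)` of the product sextic of two binary cubics. -/
def Ic {A : Type*} [CommRing A] (a b : Fin 4 → A) : A :=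
  228*a 0*b 0*a 3*b 3 - 52*a 1*b 0*a 3*b 2 - 24*a 1*b 0*a 2*b 3 - 24*a 0*b 1*a 3*b 2
  - 52*a 0*b 1*a 2*b 3 + 4*a 2*b 0*a 3*b 1 + 16*a 2^2*b 0*b 2 + 16*a 1*b 1^2*a 3
  + 4*a 1*b 1*a 2*b 2 + 16*a 1^2*b 1*b 3 + 16*a 0*b 2^2*a 2 + 4*a 0*b 2*a 1*b 3
  - 6*a 3^2*b 0^2 - 6*a 2^2*b 1^2 - 6*a 1^2*b 2^2 - 6*a 0^2*b 3^2
open MvPolynomial in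
lemma coeff_aux {k : Type*} [CommSemiring k] (m n m' n' : ℕ) (c : k) :
    coeff (Finsupp.single (0 : Fin 2) m + Finsupp.single 1 n)
      (C c * X (0 : Fin 2) ^ m' * X 1 ^ n' : MvPolynomial (Fin 2) k)
      = if m' = m ∧ n' = n then c else 0 := by
  have h : (C c * X (0 : Fin 2) ^ m' * X 1 ^ n' : MvPolynomial (Fin 2) k)
      = monomial (Finsupp.single (0 : Fin 2) m' + Finsupp.single 1 n') c := by
    rw [X_pow_eq_monomial, X_pow_eq_monomial, C_mul_monomial, monomial_mul]
    simp
  rw [h, coeff_monomial]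
  congr 1
  apply propext
  constructor
  · intro h
    have h0 := DFunLike.congr_fun h 0
    have h1 := DFunLike.congr_fun h 1
    simp at h0 h1
    exact ⟨h0, h1⟩
  · rintro ⟨rfl, rfl⟩
    rfl

/-- Explicit action on cubic coefficients. -/
def act {k : Type*} [CommRing k] (M : Matrix (Fin 2) (Fin 2) k) (a : Fin 4 → k) : Fin 4 → k :=
  ![a 0 * M 0 0 ^ 3 + a 1 * M 0 0 ^ 2 * M 1 0 + a 2 * M 0 0 * M 1 0 ^ 2 + a 3 * M 1 0 ^ 3,
    3 * a 0 * M 0 0 ^ 2 * M 0 1 + a 1 * (M 0 0 ^ 2 * M 1 1 + 2 * M 0 0 * M 0 1 * M 1 0)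
      + a 2 * (2 * M 0 0 * M 1 0 * M 1 1 + M 0 1 * M 1 0 ^ 2) + 3 * a 3 * M 1 0 ^ 2 * M 1 1,
    3 * a 0 * M 0 0 * M 0 1 ^ 2 + a 1 * (M 0 1 ^ 2 * M 1 0 + 2 * M 0 0 * M 0 1 * M 1 1)
      + a 2 * (M 0 0 * M 1 1 ^ 2 + 2 * M 0 1 * M 1 0 * M 1 1) + 3 * a 3 * M 1 0 * M 1 1 ^ 2,
    a 0 * M 0 1 ^ 3 + a 1 * M 0 1 ^ 2 * M 1 1 + a 2 * M 0 1 * M 1 1 ^ 2 + a 3 * M 1 1 ^ 3]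

lemma formCoeff_toForm {k : Type*} [CommRing k] (a : Fin 4 → k) :
    formCoeff k 3 (toForm k 3 a) = a := by
  funext i
  unfold formCoeff toForm
  rw [MvPolynomial.coeff_sum]
  simp only [coeff_aux]
  fin_cases i <;> simp [Fin.sum_univ_four]

lemma actCoeff_eq {k : Type*} [CommRing k] (M : Matrix (Fin 2) (Fin 2) k) (a : Fin 4 → k) :
    actCoeff k 3 M a = act M a := by
  have h : matAct k M (toForm k 3 a) = toForm k 3 (act M a) := by
    have hC2 : (C (2 : k) : MvPolynomial (Fin 2) k) = 2 := map_ofNat C 2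
    have hC3 : (C (3 : k) : MvPolynomial (Fin 2) k) = 3 := map_ofNat C 3
    unfold matAct toForm act
    simp [Fin.sum_univ_four, hC2, hC3]
    ring
  unfold actCoeff
  rw [h, formCoeff_toForm]

section
variable {k : Type*} [Field k]

lemma act_mul (M N : Matrix (Fin 2) (Fin 2) k) (a : Fin 4 → k) :
    act (M * N) a = act N (act M a) := by
  funext i
  fin_cases i <;> simp [act, Matrix.mul_apply, Fin.sum_univ_two] <;> ring

lemma act_one (a : Fin 4 → k) : act (1 : Matrix (Fin 2) (Fin 2) k) a = a := by
  funext i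
  fin_cases i <;> simp [act]

lemma act_smul (M : Matrix (Fin 2) (Fin 2) k) (c : k) (a : Fin 4 → k) :
    act M (c • a) = c • act M a := by
  funext i
  fin_cases i <;> simp [act] <;> ring

lemma act_add (M : Matrix (Fin 2) (Fin 2) k) (a b : Fin 4 → k) :
    act M (a + b) = act M a + act M b := by
  funext i
  fin_cases i <;> simp [act] <;> ring

lemma disc_act (M : Matrix (Fin 2) (Fin 2) k) (a : Fin 4 → k) :
    discCubic (act M a) = M.det ^ 6 * discCubic a := by
  rw [Matrix.det_fin_two]
  simp only [discCubic, act, Matrix.cons_val]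
  ring

lemma disc_smul (c : k) (a : Fin 4 → k) : discCubic (c • a) = c ^ 4 * discCubic a := by
  simp [discCubic]; ring

lemma H_act (M : Matrix (Fin 2) (Fin 2) k) (a b : Fin 4 → k) :
    Hc (act M a) (act M b) = M.det ^ 3 * Hc a b := by
  rw [Matrix.det_fin_two]
  simp only [Hc, act, Matrix.cons_val]
  ring

/-- Plücker coordinates. -/
def pl (a b : Fin 4 → k) (i j : Fin 4) : k := a i * b j - a j * b i

/-- Bezout matrix. -/
def bez (a b : Fin 4 → k) : Matrix (Fin 3) (Fin 3) k :=
  !![pl a b 0 1, pl a b 0 2, pl a b 0 3;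
     pl a b 0 2, pl a b 0 3 + pl a b 1 2, pl a b 1 3;
     pl a b 0 3, pl a b 1 3, pl a b 2 3]

/-- Symmetric square. -/
def sq2 (M : Matrix (Fin 2) (Fin 2) k) : Matrix (Fin 3) (Fin 3) k :=
  !![M 0 0 ^ 2, M 0 0 * M 1 0, M 1 0 ^ 2;
     2 * M 0 0 * M 0 1, M 0 0 * M 1 1 + M 0 1 * M 1 0, 2 * M 1 0 * M 1 1;
     M 0 1 ^ 2, M 0 1 * M 1 1, M 1 1 ^ 2]

lemma R_bez (a b : Fin 4 → k) : Rc a b = -(bez a b).det := by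
  rw [Matrix.det_fin_three]
  simp [Rc, bez, pl]
  ring

lemma det_sq2 (M : Matrix (Fin 2) (Fin 2) k) : (sq2 M).det = M.det ^ 3 := by
  rw [Matrix.det_fin_three, Matrix.det_fin_two]
  simp [sq2]
  ring

lemma bez_act (M : Matrix (Fin 2) (Fin 2) k) (a b : Fin 4 → k) :
    bez (act M a) (act M b) = M.det • (sq2 M * bez a b * (sq2 M).transpose) := by
  rw [Matrix.det_fin_two]
  ext i j
  simp only [Matrix.smul_apply, Matrix.mul_apply, Fin.sum_univ_three, Matrix.transpose_apply]
  fin_cases i <;> fin_cases j <;> simp [bez, sq2, pl, act] <;> ring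

lemma R_act (M : Matrix (Fin 2) (Fin 2) k) (a b : Fin 4 → k) :
    Rc (act M a) (act M b) = M.det ^ 9 * Rc a b := by
  rw [R_bez, R_bez, bez_act, Matrix.det_smul, Matrix.det_mul, Matrix.det_mul,
    Matrix.det_transpose, det_sq2]
  simp
  ring

lemma R_smul (c d : k) (a b : Fin 4 → k) : Rc (c • a) (d • b) = (c * d) ^ 3 * Rc a b := by
  simp [Rc]; ring
lemma H_smul (c d : k) (a b : Fin 4 → k) : Hc (c • a) (d • b) = (c * d) * Hc a b := by
  simp [Hc]; ring
lemma I_smul (c d : k) (a b : Fin 4 → k) : Ic (c • a) (d • b) = (c * d) ^ 2 * Ic a b := by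
  simp [Ic]; ring
lemma D_smul (c d : k) (a b : Fin 4 → k) : Dc (c • a) (d • b) = (c * d) ^ 4 * Dc a b := by
  simp [Dc, disc_smul]; ring

lemma I_eq (a b : Fin 4 → k) : 3 * Ic a b =
    -14 * Hc a b ^ 2 - 2 * (discCubic (a + b) + discCubic (a + (-1 : k) • b)
      - 2 * discCubic a - 2 * discCubic b) := by
  simp [Ic, Hc, discCubic]
  ring


lemma I_act (h3 : (3 : k) ≠ 0) (M : Matrix (Fin 2) (Fin 2) k) (a b : Fin 4 → k) :
    Ic (act M a) (act M b) = M.det ^ 6 * Ic a b := by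
  apply mul_left_cancel₀ h3
  rw [I_eq, H_act, ← act_smul, ← act_add, ← act_add, disc_act, disc_act, disc_act, disc_act]
  linear_combination (-M.det ^ 6) * I_eq a b

lemma D_act (M : Matrix (Fin 2) (Fin 2) k) (a b : Fin 4 → k) :
    Dc (act M a) (act M b) = M.det ^ 12 * Dc a b := by
  simp only [Dc, disc_act]; ring

/-- `12` times the invariant of bidegree `(1,3)`. -/
def Q3 (a b : Fin 4 → k) : k :=
  discCubic (a + (2 : k) • b) - discCubic (a + (-2 : k) • b)
    - 2 * discCubic (a + (1 : k) • b) + 2 * discCubic (a + (-1 : k) • b)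

/-- The auxiliary invariant of bidegree `(6,6)`. -/
def Tc (a b : Fin 4 → k) : k := discCubic a * Q3 a b ^ 2

lemma Q3_act (M : Matrix (Fin 2) (Fin 2) k) (a b : Fin 4 → k) :
    Q3 (act M a) (act M b) = M.det ^ 6 * Q3 a b := by
  simp only [Q3, ← act_smul, ← act_add, disc_act]
  ring

lemma Q3_eq (a b : Fin 4 → k) : Q3 a b = 12 * (
    -54 * (a 0 * b 0 * b 3 ^ 2 + b 0 ^ 2 * a 3 * b 3)
    + 18 * (a 0 * b 3 * b 2 * b 1 + b 0 * a 3 * b 2 * b 1 + b 0 * b 3 * a 2 * b 1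
      + b 0 * b 3 * b 2 * a 1)
    + 2 * (a 1 * b 1 * b 2 ^ 2 + b 1 ^ 2 * a 2 * b 2)
    - 4 * (3 * a 1 * b 1 ^ 2 * b 3 + b 1 ^ 3 * a 3)
    - 4 * (3 * a 2 * b 2 ^ 2 * b 0 + b 2 ^ 3 * a 0)) := by
  simp [Q3, discCubic]
  ring

lemma T_act (M : Matrix (Fin 2) (Fin 2) k) (a b : Fin 4 → k) :
    Tc (act M a) (act M b) = M.det ^ 18 * Tc a b := by
  simp only [Tc, Q3_act, disc_act]; ring

lemma T_smul (c d : k) (a b : Fin 4 → k) : Tc (c • a) (d • b) = (c * d) ^ 6 * Tc a b := by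
  simp [Tc, Q3_eq, disc_smul]; ring

/-- Conjugacy without swap. -/
def Conj0 (a b a' b' : Fin 4 → k) : Prop :=
  ∃ M : GL (Fin 2) k, ∃ c : kˣ, a' = (c : k) • act (M : Matrix (Fin 2) (Fin 2) k) a ∧
    b' = ((c⁻¹ : kˣ) : k) • act (M : Matrix (Fin 2) (Fin 2) k) b

lemma Conj0.trans {a b a' b' a'' b'' : Fin 4 → k} (h : Conj0 a b a' b')
    (h' : Conj0 a' b' a'' b'') : Conj0 a b a'' b'' := by
  obtain ⟨M, c, rfl, rfl⟩ := h
  obtain ⟨N, d, rfl, rfl⟩ := h'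
  refine ⟨M * N, d * c, ?_, ?_⟩
  · simp only [Units.val_mul, act_mul, act_smul, smul_smul]
  · simp only [mul_inv, Units.val_mul, act_mul, act_smul, smul_smul]

lemma Conj0.symm {a b a' b' : Fin 4 → k} (h : Conj0 a b a' b') : Conj0 a' b' a b := by
  obtain ⟨M, c, rfl, rfl⟩ := h
  have h1 : ∀ x, act ((M⁻¹ : GL (Fin 2) k) : Matrix (Fin 2) (Fin 2) k)
      (act (M : Matrix (Fin 2) (Fin 2) k) x) = x := by
    intro x
    rw [← act_mul, ← Units.val_mul, mul_inv_cancel, Units.val_one, act_one]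
  refine ⟨M⁻¹, c⁻¹, ?_, ?_⟩
  · rw [act_smul, h1, smul_smul, ← Units.val_mul]; simp
  · rw [act_smul, h1, smul_smul, ← Units.val_mul]; simp

/-- The four invariants agree up to scaling. -/
def Rel4 (r : k) (a b a' b' : Fin 4 → k) : Prop :=
  r ≠ 0 ∧ Hc a b = r^2 * Hc a' b' ∧ Ic a b = r^4 * Ic a' b' ∧
      Rc a b = r^6 * Rc a' b' ∧ Dc a b = r^8 * Dc a' b'

/-- The five invariants agree up to scaling. -/
def Rel5 (r : k) (a b a' b' : Fin 4 → k) : Prop :=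
  Rel4 r a b a' b' ∧ Tc a b = r^12 * Tc a' b'

lemma Rel4.trans {r t : k} {a b a' b' a'' b'' : Fin 4 → k} (h : Rel4 r a b a' b')
    (h' : Rel4 t a' b' a'' b'') : Rel4 (r * t) a b a'' b'' := by
  obtain ⟨h0, h1, h2, h3, h4⟩ := h
  obtain ⟨h0', h1', h2', h3', h4'⟩ := h'
  refine ⟨mul_ne_zero h0 h0', ?_, ?_, ?_, ?_⟩
  · rw [h1, h1']; ring
  · rw [h2, h2']; ring
  · rw [h3, h3']; ring
  · rw [h4, h4']; ring

lemma Rel5.trans {r t : k} {a b a' b' a'' b'' : Fin 4 → k} (h : Rel5 r a b a' b')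
    (h' : Rel5 t a' b' a'' b'') : Rel5 (r * t) a b a'' b'' := by
  refine ⟨h.1.trans h'.1, ?_⟩
  rw [h.2, h'.2]; ring

lemma Rel5_swap {i : k} (hi : i ^ 2 = -1) {a b a' b' : Fin 4 → k}
    (h : Rel4 1 a b a' b') (hT : Tc a b = Tc b' a') : Rel5 i a b b' a' := by
  obtain ⟨h0, h1, h2, h3, h4⟩ := h
  have i0 : i ≠ 0 := by
    rintro rfl
    simp at hi
  have i4 : i ^ 4 = 1 := by linear_combination (i ^ 2 - 1) * hi
  have i6 : i ^ 6 = -1 := by linear_combination (i ^ 4 - i ^ 2 + 1) * hi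
  have i8 : i ^ 8 = 1 := by linear_combination (i ^ 4 + 1) * i4
  have i12 : i ^ 12 = 1 := by linear_combination (i ^ 8 + i ^ 4 + 1) * i4
  refine ⟨⟨i0, ?_, ?_, ?_, ?_⟩, ?_⟩
  · rw [h1, hi]; simp only [Hc]; ring
  · rw [h2, i4]; simp only [Ic]; ring
  · rw [h3, i6]; simp only [Rc]; ring
  · rw [h4, i8]; simp only [Dc]; ring
  · rw [hT, i12]; ring

variable [IsAlgClosed k]

lemma Conj0.rel (h3 : (3 : k) ≠ 0) {a b a' b' : Fin 4 → k} (h : Conj0 a b a' b') :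
    ∃ r, Rel5 r a b a' b' := by
  obtain ⟨M, c, rfl, rfl⟩ := h
  set M' : Matrix (Fin 2) (Fin 2) k := (M : Matrix (Fin 2) (Fin 2) k) with hM
  have hd : M'.det ≠ 0 := by
    have := M.isUnit.map Matrix.detMonoidHom
    exact this.ne_zero
  obtain ⟨r, hr⟩ := IsAlgClosed.exists_pow_nat_eq ((M'.det ^ 3)⁻¹) (n := 2) (by norm_num)
  have hr' : r ^ 2 * M'.det ^ 3 = 1 := by rw [hr]; field_simp
  have hc : (c : k) * ((c⁻¹ : kˣ) : k) = 1 := by simp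
  refine ⟨r, ⟨⟨?_, ?_, ?_, ?_, ?_⟩, ?_⟩⟩
  · rintro rfl
    simp at hr'
  · rw [H_smul, H_act, hc]
    linear_combination (-Hc a b) * hr'
  · rw [I_smul, I_act h3, hc]
    linear_combination (-Ic a b) * (r ^ 2 * M'.det ^ 3 + 1) * hr'
  · rw [R_smul, R_act, hc]
    linear_combination (-Rc a b) * ((r ^ 2 * M'.det ^ 3) ^ 2 + r ^ 2 * M'.det ^ 3 + 1) * hr'
  · rw [D_smul, D_act, hc]
    linear_combination (-Dc a b) * ((r ^ 2 * M'.det ^ 3) ^ 2 + 1) *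
      (r ^ 2 * M'.det ^ 3 + 1) * hr'
  · rw [T_smul, T_act, hc]
    linear_combination (-Tc a b) * ((r ^ 2 * M'.det ^ 3) ^ 3 + 1) *
      ((r ^ 2 * M'.det ^ 3) ^ 2 + r ^ 2 * M'.det ^ 3 + 1) * hr'

/-- Conjugacy from explicit matrix entries. -/
lemma Conj0.mk' {a b a' b' : Fin 4 → k} (p q r s c d : k) (hd : p * s - q * r ≠ 0)
    (hc : c * d = 1) (h1 : a' = c • act !![p, q; r, s] a) (h2 : b' = d • act !![p, q; r, s] b) :
    Conj0 a b a' b' := by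
  refine ⟨Matrix.GeneralLinearGroup.mkOfDetNeZero !![p, q; r, s] ?_,
    ⟨c, d, hc, by rw [mul_comm]; exact hc⟩, h1, h2⟩
  rw [Matrix.det_fin_two]
  simpa using hd

/-- The cubic `X³ + Y³`. -/
def ee : Fin 4 → k := ![1, 0, 0, 1]

lemma Conj0_scale (b : Fin 4 → k) (u : k) (hu : u ≠ 0) : Conj0 ee b ee (u • b) := by
  obtain ⟨t, ht⟩ := IsAlgClosed.exists_pow_nat_eq u (n := 6) (by norm_num)
  have t0 : t ≠ 0 := by
    rintro rfl
    simp at ht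
    exact hu ht.symm
  refine Conj0.mk' t 0 0 t ((t ^ 3)⁻¹) (t ^ 3) (by simpa using t0) (by field_simp) ?_ ?_
  · funext i
    fin_cases i <;> simp [act, ee] <;> field_simp
  · funext i
    fin_cases i <;> simp [act, ← ht] <;> ring

lemma Conj0_flip {i : k} (hi : i ^ 2 = -1) (b : Fin 4 → k) :
    Conj0 ee b ee ![-b 3, -b 2, -b 1, -b 0] := by
  have i0 : i ≠ 0 := by
    rintro rfl
    simp at hi
  refine Conj0.mk' 0 i i 0 i (-i) (by simpa using i0) (by linear_combination -hi) ?_ ?_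
  · funext j
    fin_cases j <;> simp [act, ee]
    · linear_combination (1 - i ^ 2) * hi
    · linear_combination (1 - i ^ 2) * hi
  · funext j
    fin_cases j <;> simp [act]
    · linear_combination b 3 * (1 - i ^ 2) * hi
    · linear_combination b 2 * (1 - i ^ 2) * hi
    · linear_combination b 1 * (1 - i ^ 2) * hi
    · linear_combination b 0 * (1 - i ^ 2) * hi

lemma Conj0_omega {w : k} (hw : w ^ 3 = 1) (b b' : Fin 4 → k) (h0 : b' 0 = b 0)
    (h1 : b' 1 = w * b 1) (h2 : b' 2 = w ^ 2 * b 2) (h3 : b' 3 = b 3) : Conj0 ee b ee b' := by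
  have w0 : w ≠ 0 := by
    rintro rfl
    simp at hw
  refine Conj0.mk' 1 0 0 w 1 1 (by simpa using w0) (by ring) ?_ ?_
  · funext j
    fin_cases j <;> simp [act, ee, hw]
  · funext j
    fin_cases j <;> simp [act, hw, h0, h1, h2, h3] <;> ring

lemma exists_normal_cubic (h3 : (3 : k) ≠ 0) (h2 : (2 : k) ≠ 0) (a : Fin 4 → k)
    (ha : discCubic a ≠ 0) (b : Fin 4 → k) :
    ∃ b', Conj0 a b ee b' := by
  -- Step 1: diagonalise the Hessian.
  set A := a 1 ^ 2 - 3 * a 0 * a 2 with hA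
  set B := a 1 * a 2 - 9 * a 0 * a 3 with hB
  set C' := a 2 ^ 2 - 3 * a 1 * a 3 with hC
  have hdisc : B ^ 2 - 4 * A * C' = -3 * discCubic a := by
    rw [hA, hB, hC, discCubic]; ring
  have hne : B ^ 2 - 4 * A * C' ≠ 0 := by
    rw [hdisc]
    exact mul_ne_zero (neg_ne_zero.mpr h3) ha
  obtain ⟨p, q, r, s, hd, hz1, hz2⟩ : ∃ p q r s : k, p * s - q * r ≠ 0 ∧
      A * p ^ 2 + B * p * r + C' * r ^ 2 = 0 ∧ A * q ^ 2 + B * q * s + C' * s ^ 2 = 0 := by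
    clear_value A B C'
    by_cases hA0 : A = 0
    · subst hA0
      refine ⟨1, -C', 0, B, ?_, by ring, by ring⟩
      intro h
      apply hne
      linear_combination B * h
    · obtain ⟨δ, hδ⟩ := IsAlgClosed.exists_pow_nat_eq (B ^ 2 - 4 * A * C') (n := 2) (by norm_num)
      have δ0 : δ ≠ 0 := by
        rintro rfl
        apply hne
        rw [← hδ]; ring
      refine ⟨-B + δ, -B - δ, 2 * A, 2 * A, ?_, ?_, ?_⟩
      · have : (-B + δ) * (2 * A) - (-B - δ) * (2 * A) = 2 * 2 * A * δ := by ring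
        rw [this]
        exact mul_ne_zero (mul_ne_zero (mul_ne_zero h2 h2) hA0) δ0
      · linear_combination A * hδ
      · linear_combination A * hδ
  set a' := act !![p, q; r, s] a with ha'
  have e1 : a' 1 ^ 2 - 3 * a' 0 * a' 2 = 0 := by
    have : a' 1 ^ 2 - 3 * a' 0 * a' 2
        = (p * s - q * r) ^ 2 * (A * p ^ 2 + B * p * r + C' * r ^ 2) := by
      rw [ha', hA, hB, hC]; simp [act]; ring
    rw [this, hz1, mul_zero]
  have e2 : a' 2 ^ 2 - 3 * a' 1 * a' 3 = 0 := by
    have : a' 2 ^ 2 - 3 * a' 1 * a' 3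
        = (p * s - q * r) ^ 2 * (A * q ^ 2 + B * q * s + C' * s ^ 2) := by
      rw [ha', hA, hB, hC]; simp [act]; ring
    rw [this, hz2, mul_zero]
  have ed : discCubic a' ≠ 0 := by
    rw [ha', disc_act, Matrix.det_fin_two]
    apply mul_ne_zero _ ha
    apply pow_ne_zero
    simpa using hd
  have hc1 : Conj0 a b a' (act !![p, q; r, s] b) :=
    Conj0.mk' p q r s 1 1 hd (by ring) (by rw [one_smul]) (by rw [one_smul])
  generalize act !![p, q; r, s] b = b1 at hc1
  clear_value a'
  clear ha'
  -- Step 2: middle coefficients vanish.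
  have ed' : a' 1 * a' 2 - 9 * a' 0 * a' 3 ≠ 0 := by
    intro h
    apply ed
    have h' : 3 * discCubic a' = 0 := by
      rw [discCubic]
      linear_combination 4 * (a' 2 ^ 2 - 3 * a' 1 * a' 3) * e1
        - (a' 1 * a' 2 - 9 * a' 0 * a' 3) * h
    exact (mul_eq_zero.mp h').resolve_left h3
  have e12 : a' 1 * a' 2 = 0 := by
    have : (a' 1 * a' 2) * (a' 1 * a' 2 - 9 * a' 0 * a' 3) = 0 := by
      linear_combination a' 2 ^ 2 * e1 + 3 * a' 0 * a' 2 * e2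
    exact (mul_eq_zero.mp this).resolve_right ed'
  have f1 : a' 1 = 0 := by
    have : a' 1 ^ 3 = 0 := by linear_combination a' 1 * e1 + 3 * a' 0 * e12
    exact pow_eq_zero_iff (by norm_num) |>.mp this
  have f2 : a' 2 = 0 := by
    have : a' 2 ^ 3 = 0 := by linear_combination a' 2 * e2 + 3 * a' 3 * e12
    exact pow_eq_zero_iff (by norm_num) |>.mp this
  have f0 : a' 0 ≠ 0 := by
    intro h; apply ed'; rw [f1, h]; ring
  have f3 : a' 3 ≠ 0 := by
    intro h; apply ed'; rw [f1, h]; ring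
  obtain ⟨x, hx⟩ := IsAlgClosed.exists_pow_nat_eq ((a' 0)⁻¹) (n := 3) (by norm_num)
  obtain ⟨y, hy⟩ := IsAlgClosed.exists_pow_nat_eq ((a' 3)⁻¹) (n := 3) (by norm_num)
  have x0 : x ≠ 0 := by
    rintro rfl
    simp at hx
    exact f0 hx.symm
  have y0 : y ≠ 0 := by
    rintro rfl
    simp at hy
    exact f3 hy.symm
  refine ⟨act !![x, 0; 0, y] b1, hc1.trans ?_⟩
  refine Conj0.mk' x 0 0 y 1 1 (by simpa using ⟨x0, y0⟩) (by ring) ?_ (by rw [one_smul])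
  funext j
  fin_cases j <;> simp [act, ee, f1, f2, hx, hy, f0, f3]

/-- `H/3` of `(ee, b)`. -/
def dd (b : Fin 4 → k) : k := b 3 - b 0
/-- Proportional to the invariant of bidegree `(3,1)` of `(ee, b)`. -/
def ss (b : Fin 4 → k) : k := b 0 + b 3
/-- Normalised `I`. -/
def c1 (b : Fin 4 → k) : k := 9 * ss b ^ 2 - 4 * (b 1 * b 2)
/-- Normalised `R`. -/
def c2 (b : Fin 4 → k) : k := b 1 ^ 3 - b 2 ^ 3 + 3 * (b 1 * b 2) * dd b
/-- The invariant of bidegree `(1,3)` of `(ee, b)`. -/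
def qq (b : Fin 4 → k) : k :=
  -54 * (b 0 * b 3) * ss b + 18 * (b 1 * b 2) * ss b - 4 * (b 1 ^ 3 + b 2 ^ 3)

lemma kappa_eq (b : Fin 4 → k) : 8 * (ss b * qq b) =
    -c1 b ^ 2 + 27 * dd b ^ 4 + 6 * c1 b * dd b ^ 2 + 32 * c2 b * dd b + 16 * discCubic b := by
  simp only [c1, c2, qq, ss, dd, discCubic]; ring

lemma qq_sq (b : Fin 4 → k) : qq b ^ 2 = 108 * discCubic b * ss b ^ 2 +
    ((27 * dd b ^ 2 - 9 * c1 b) * (ss b * qq b) + 16 * c2 b ^ 2 + 24 * c2 b * c1 b * dd b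
      + 9 * dd b ^ 2 * c1 b ^ 2 - c1 b ^ 3) := by
  simp only [c1, c2, qq, ss, dd, discCubic]; ring

lemma disc_ee : discCubic (ee : Fin 4 → k) = -27 := by
  simp [discCubic, ee]

lemma H_ee (b : Fin 4 → k) : Hc ee b = 3 * dd b := by
  simp [Hc, ee, dd]; ring

lemma I_ee (b : Fin 4 → k) : Ic ee b = 6 * c1 b - 60 * dd b ^ 2 := by
  simp [Ic, ee, dd, c1, ss]; ring

lemma R_ee (b : Fin 4 → k) : Rc ee b = c2 b + dd b ^ 3 := by
  simp [Rc, ee, dd, c2]; ring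

lemma D_ee (b : Fin 4 → k) : Dc ee b = -27 * discCubic b := by
  rw [Dc, disc_ee]

lemma T_ee (b : Fin 4 → k) : Tc ee b = -27 * (12 * qq b) ^ 2 := by
  rw [Tc, disc_ee, Q3_eq]
  simp only [ee, qq, ss, Matrix.cons_val]; ring

lemma T_ee' (b : Fin 4 → k) : Tc b ee = discCubic b * (12 * (-54 * ss b)) ^ 2 := by
  rw [Tc, Q3_eq]
  simp only [ee, ss, Matrix.cons_val]; ring

lemma rel4_ee (h2 : (2 : k) ≠ 0) (h3 : (3 : k) ≠ 0) {b b' : Fin 4 → k}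
    (h : Rel4 1 ee b ee b') :
    dd b = dd b' ∧ c1 b = c1 b' ∧ c2 b = c2 b' ∧ discCubic b = discCubic b' ∧
      ss b * qq b = ss b' * qq b' := by
  obtain ⟨-, hH, hI, hR, hD⟩ := h
  rw [H_ee, H_ee] at hH
  rw [I_ee, I_ee] at hI
  rw [R_ee, R_ee] at hR
  rw [D_ee, D_ee] at hD
  have e1 : dd b = dd b' := by
    apply mul_left_cancel₀ h3
    linear_combination hH
  have e2 : c1 b = c1 b' := by
    apply mul_left_cancel₀ (mul_ne_zero h2 h3)
    rw [e1] at hI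
    linear_combination hI
  have e3 : c2 b = c2 b' := by
    rw [e1] at hR
    linear_combination hR
  have e4 : discCubic b = discCubic b' := by
    apply mul_left_cancel₀ (mul_ne_zero (mul_ne_zero h3 h3) h3)
    linear_combination -hD
  refine ⟨e1, e2, e3, e4, ?_⟩
  apply mul_left_cancel₀ (mul_ne_zero (mul_ne_zero h2 h2) h2)
  have k1 := kappa_eq b
  have k2 := kappa_eq b'
  rw [e1, e2, e3, e4] at k1
  linear_combination k1 - k2

/-- The dichotomy. -/
lemma dichotomy (h2 : (2 : k) ≠ 0) (h3 : (3 : k) ≠ 0) {b b' : Fin 4 → k}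
    (hD : discCubic b ≠ 0) (h : Rel4 1 ee b ee b') :
    Tc ee b = Tc ee b' ∨ Tc ee b = Tc b' ee := by
  obtain ⟨e1, e2, e3, e4, e5⟩ := rel4_ee h2 h3 h
  have k1 := qq_sq b
  have k2 := qq_sq b'
  rw [e1, e2, e3, e4, e5] at k1
  rw [e4] at hD
  -- both `ss² ` satisfy the same quadratic equation
  have key : (ss b ^ 2 - ss b' ^ 2) * (qq b ^ 2 + 108 * discCubic b' * ss b' ^ 2) = 0 := by
    linear_combination (-ss b' ^ 2) * (k1 - k2)
      + (ss b * qq b + ss b' * qq b') * e5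
  rcases mul_eq_zero.mp key with hh | hh
  · left
    rw [T_ee, T_ee]
    linear_combination (-27 * 144) * (k1 - k2 + 108 * discCubic b' * hh)
  · right
    rw [T_ee, T_ee']
    linear_combination (-27 * 144) * hh

lemma conj_of_coeffs {b b' : Fin 4 → k} (h0 : b' 0 = b 0) (h3 : b' 3 = b 3)
    (h12 : b' 1 * b' 2 = b 1 * b 2) (h1 : b' 1 ^ 3 = b 1 ^ 3) (h2 : b' 2 ^ 3 = b 2 ^ 3) :
    Conj0 ee b ee b' := by
  by_cases hb1 : b 1 = 0
  · have hb1' : b' 1 = 0 := by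
      rw [hb1] at h1
      exact pow_eq_zero_iff (by norm_num) |>.mp (h1.trans (by ring))
    by_cases hb2 : b 2 = 0
    · have hb2' : b' 2 = 0 := by
        rw [hb2] at h2
        exact pow_eq_zero_iff (by norm_num) |>.mp (h2.trans (by ring))
      exact Conj0_omega (w := 1) (by ring) b b' h0 (by rw [hb1, hb1']; ring)
        (by rw [hb2, hb2']; ring) h3
    · have hv : (b' 2 / b 2) ^ 3 = 1 := by
        rw [div_pow, h2]; exact div_self (pow_ne_zero _ hb2)
      have hv' : b' 2 = (b' 2 / b 2) * b 2 := by field_simp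
      generalize b' 2 / b 2 = v at hv hv'
      refine Conj0_omega (w := v ^ 2) ?_ b b' h0 (by rw [hb1, hb1']; ring) ?_ h3
      · linear_combination (v ^ 3 + 1) * hv
      · rw [hv']; linear_combination (-v * b 2) * hv
  · have hv : (b' 1 / b 1) ^ 3 = 1 := by
      rw [div_pow, h1]; exact div_self (pow_ne_zero _ hb1)
    have hv' : b' 1 = (b' 1 / b 1) * b 1 := by field_simp
    generalize b' 1 / b 1 = v at hv hv'
    refine Conj0_omega (w := v) hv b b' h0 hv' ?_ h3
    apply mul_left_cancel₀ hb1
    rw [hv'] at h12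
    linear_combination v ^ 2 * h12 - (b 1 * b' 2) * hv

lemma conj_of_ss (h2 : (2 : k) ≠ 0) {b b' : Fin 4 → k}
    (e1 : dd b = dd b') (e2 : c1 b = c1 b') (e3 : c2 b = c2 b')
    (e4 : ss b = ss b') (e5 : qq b = qq b') : Conj0 ee b ee b' := by
  have h0 : b' 0 = b 0 := by
    apply mul_left_cancel₀ h2
    simp only [dd, ss] at e1 e4
    linear_combination e1 - e4
  have h3 : b' 3 = b 3 := by
    simp only [ss] at e4
    linear_combination -e4 - h0
  have h12 : b' 1 * b' 2 = b 1 * b 2 := by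
    apply mul_left_cancel₀ (mul_ne_zero h2 h2)
    simp only [c1, e4] at e2
    linear_combination e2
  have hw : b' 1 ^ 3 - b' 2 ^ 3 = b 1 ^ 3 - b 2 ^ 3 := by
    simp only [c2, e1, h12] at e3
    linear_combination -e3
  have hp : b' 1 ^ 3 + b' 2 ^ 3 = b 1 ^ 3 + b 2 ^ 3 := by
    apply mul_left_cancel₀ (mul_ne_zero h2 h2)
    simp only [qq, e4, h12, h0, h3] at e5
    linear_combination e5
  apply conj_of_coeffs h0 h3 h12
  · apply mul_left_cancel₀ h2
    linear_combination hw + hp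
  · apply mul_left_cancel₀ h2
    linear_combination hp - hw

lemma conj_of_rel5_one (h2 : (2 : k) ≠ 0) (h3 : (3 : k) ≠ 0) {b b' : Fin 4 → k}
    (hD : discCubic b ≠ 0) (h : Rel5 1 ee b ee b') : Conj0 ee b ee b' := by
  obtain ⟨e1, e2, e3, e4, e5⟩ := rel4_ee h2 h3 h.1
  have hT := h.2
  rw [T_ee, T_ee] at hT
  have hq : qq b ^ 2 = qq b' ^ 2 := by
    apply mul_left_cancel₀ (pow_ne_zero 5 h3)
    apply mul_left_cancel₀ (pow_ne_zero 4 h2)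
    linear_combination -hT
  have k1 := qq_sq b
  have k2 := qq_sq b'
  rw [e1, e2, e3, e4, e5] at k1
  rw [e4] at hD
  have hs : ss b ^ 2 = ss b' ^ 2 := by
    apply mul_left_cancel₀ hD
    apply mul_left_cancel₀ (pow_ne_zero 3 h3)
    apply mul_left_cancel₀ (pow_ne_zero 2 h2)
    linear_combination hq - k1 + k2
  have hor : (ss b = ss b' ∧ qq b = qq b') ∨ (ss b = -ss b' ∧ qq b = -qq b') := by
    rcases sq_eq_sq_iff_eq_or_eq_neg.mp hs with hs1 | hs1
    · by_cases h0 : ss b' = 0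
      · rcases sq_eq_sq_iff_eq_or_eq_neg.mp hq with hq1 | hq1
        · exact Or.inl ⟨hs1, hq1⟩
        · exact Or.inr ⟨by rw [hs1, h0, neg_zero], hq1⟩
      · left
        refine ⟨hs1, mul_left_cancel₀ h0 ?_⟩
        rw [← e5, hs1]
    · by_cases h0 : ss b' = 0
      · rcases sq_eq_sq_iff_eq_or_eq_neg.mp hq with hq1 | hq1
        · exact Or.inl ⟨by rw [hs1, h0, neg_zero], hq1⟩
        · exact Or.inr ⟨hs1, hq1⟩
      · right
        refine ⟨hs1, mul_left_cancel₀ h0 ?_⟩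
        rw [hs1] at e5
        linear_combination -e5
  rcases hor with ⟨hs1, hq1⟩ | ⟨hs1, hq1⟩
  · exact conj_of_ss h2 e1 e2 e3 hs1 hq1
  · obtain ⟨i, hi⟩ := IsAlgClosed.exists_pow_nat_eq (-1 : k) (n := 2) (by norm_num)
    refine (Conj0_flip hi b).trans (conj_of_ss h2 ?_ ?_ ?_ ?_ ?_)
    · rw [← e1]; simp [dd] <;> ring
    · rw [← e2]; simp [c1, ss] <;> ring
    · rw [← e3]; simp [c2, dd] <;> ring
    · rw [← neg_eq_iff_eq_neg.mpr hs1]; simp [ss] <;> ring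
    · rw [← neg_eq_iff_eq_neg.mpr hq1]; simp [qq, ss] <;> ring

lemma rel_scale {r : k} {b b' : Fin 4 → k} (h : Rel4 r ee b ee b') :
    Rel4 1 ee b ee ((r ^ 2) • b') := by
  obtain ⟨h0, h1, h2, h3, h4⟩ := h
  refine ⟨one_ne_zero, ?_, ?_, ?_, ?_⟩
  · have e := H_smul 1 (r ^ 2) ee b'
    rw [one_smul] at e
    rw [h1, e]; ring
  · have e := I_smul 1 (r ^ 2) ee b'
    rw [one_smul] at e
    rw [h2, e]; ring
  · have e := R_smul 1 (r ^ 2) ee b'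
    rw [one_smul] at e
    rw [h3, e]; ring
  · have e := D_smul 1 (r ^ 2) ee b'
    rw [one_smul] at e
    rw [h4, e]; ring

lemma rel5_scale {r : k} {b b' : Fin 4 → k} (h : Rel5 r ee b ee b') :
    Rel5 1 ee b ee ((r ^ 2) • b') := by
  refine ⟨rel_scale h.1, ?_⟩
  have e := T_smul 1 (r ^ 2) ee b'
  rw [one_smul] at e
  rw [h.2, e]; ring

lemma conj_of_rel5 (h2 : (2 : k) ≠ 0) (h3 : (3 : k) ≠ 0) {b b' : Fin 4 → k} {r : k}
    (hD : discCubic b ≠ 0) (h : Rel5 r ee b ee b') : Conj0 ee b ee b' :=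
  (conj_of_rel5_one h2 h3 hD (rel5_scale h)).trans
    (Conj0_scale b' (r ^ 2) (pow_ne_zero 2 h.1.1)).symm

lemma conj_of_rel4 (h2 : (2 : k) ≠ 0) (h3 : (3 : k) ≠ 0) {f1 f2 g1 g2 : Fin 4 → k} {r : k}
    (hf : Dc f1 f2 ≠ 0) (hg : Dc g1 g2 ≠ 0) (h : Rel4 r f1 f2 g1 g2) :
    Conj0 f1 f2 g1 g2 ∨ Conj0 f1 f2 g2 g1 := by
  obtain ⟨b, hb⟩ := exists_normal_cubic h3 h2 f1 (left_ne_zero_of_mul hf) f2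
  obtain ⟨b', hb'⟩ := exists_normal_cubic h3 h2 g1 (left_ne_zero_of_mul hg) g2
  obtain ⟨c, hc⟩ := exists_normal_cubic h3 h2 g2 (right_ne_zero_of_mul hg) g1
  obtain ⟨r1, hr1⟩ := hb.symm.rel h3
  obtain ⟨r2, hr2⟩ := hb'.rel h3
  have hrel := (hr1.1.trans h).trans hr2.1
  have hDb : discCubic b ≠ 0 := by
    have := hr1.1.2.2.2.2
    rw [D_ee] at this
    intro h0
    rw [h0, mul_zero] at this
    exact mul_ne_zero (pow_ne_zero 8 hr1.1.1) hf this.symm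
  have hs := Conj0_scale b' _ (pow_ne_zero 2 hrel.1)
  have hrel1 := rel_scale hrel
  generalize ((r1 * r * r2) ^ 2) • b' = b'' at hs hrel1
  rcases dichotomy h2 h3 hDb hrel1 with hT | hT
  · left
    have : Rel5 1 ee b ee b'' := ⟨hrel1, by rw [hT]; ring⟩
    exact (hb.trans (conj_of_rel5 h2 h3 hDb this)).trans (hb'.trans hs).symm
  · right
    obtain ⟨i, hi⟩ := IsAlgClosed.exists_pow_nat_eq (-1 : k) (n := 2) (by norm_num)
    have h5 : Rel5 i ee b b'' ee := Rel5_swap hi hrel1 hT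
    have hg' : Conj0 g2 g1 b'' ee := by
      obtain ⟨M, u, hu1, hu2⟩ := hb'.trans hs
      exact ⟨M, u⁻¹, hu2, by rw [inv_inv]; exact hu1⟩
    have hcc : Conj0 b'' ee ee c := hg'.symm.trans hc
    obtain ⟨t, ht⟩ := hcc.rel h3
    exact (hb.trans (conj_of_rel5 h2 h3 hDb (h5.trans ht))).trans hc.symm

end

/-- Two pairs of binary cubics with `R·D ≠ 0` are conjugate under `GL₂(k) × Γ` iff
their invariants `H, I, R, D` agree up to the scalings `r², r⁴, r⁶, r⁸`. -/
theorem cubic_pairs_conjugate_iff_invariants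
    (k : Type*) [Field k] [IsAlgClosed k]
    (h2 : (2 : k) ≠ 0) (h3 : (3 : k) ≠ 0)
    (f1 f2 g1 g2 : Fin 4 → k)
    (hf : Rc f1 f2 * Dc f1 f2 ≠ 0) (hg : Rc g1 g2 * Dc g1 g2 ≠ 0) :
    (∃ M : GL (Fin 2) k, ∃ c : kˣ,
      ((g1 = fun i => (c : k) * actCoeff k 3 (M : Matrix (Fin 2) (Fin 2) k) f1 i) ∧
       (g2 = fun i => ((c⁻¹ : kˣ) : k) * actCoeff k 3 (M : Matrix (Fin 2) (Fin 2) k) f2 i)) ∨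
      ((g1 = fun i => (c : k) * actCoeff k 3 (M : Matrix (Fin 2) (Fin 2) k) f2 i) ∧
       (g2 = fun i => ((c⁻¹ : kˣ) : k) * actCoeff k 3 (M : Matrix (Fin 2) (Fin 2) k) f1 i))) ↔
    (∃ r : k, r ≠ 0 ∧
      Hc f1 f2 = r^2 * Hc g1 g2 ∧
      Ic f1 f2 = r^4 * Ic g1 g2 ∧
      Rc f1 f2 = r^6 * Rc g1 g2 ∧
      Dc f1 f2 = r^8 * Dc g1 g2) := by
  have hDf : Dc f1 f2 ≠ 0 := right_ne_zero_of_mul hf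
  have hDg : Dc g1 g2 ≠ 0 := right_ne_zero_of_mul hg
  simp only [actCoeff_eq]
  constructor
  · rintro ⟨M, c, ⟨e1, e2⟩ | ⟨e1, e2⟩⟩
    · obtain ⟨r, hr⟩ := Conj0.rel h3 (⟨M, c, e1, e2⟩ : Conj0 f1 f2 g1 g2)
      exact ⟨r, hr.1⟩
    · obtain ⟨i, hi⟩ := IsAlgClosed.exists_pow_nat_eq (-1 : k) (n := 2) (by norm_num)
      obtain ⟨r, hr⟩ := Conj0.rel h3 (⟨M, c, e1, e2⟩ : Conj0 f2 f1 g1 g2)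
      have hsw : Rel4 i f1 f2 f2 f1 := by
        have i0 : i ≠ 0 := by
          rintro rfl
          simp at hi
        refine ⟨i0, ?_, ?_, ?_, ?_⟩
        · rw [hi]; simp only [Hc]; ring
        · rw [show i ^ 4 = 1 by linear_combination (i ^ 2 - 1) * hi]; simp only [Ic]; ring
        · rw [show i ^ 6 = -1 by linear_combination (i ^ 4 - i ^ 2 + 1) * hi]
          simp only [Rc]; ring
        · rw [show i ^ 8 = 1 by linear_combination (i ^ 4 + 1) * (i ^ 2 - 1) * hi]
          simp only [Dc]; ring
      exact ⟨i * r, hsw.trans hr.1⟩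
  · rintro ⟨r, hr⟩
    rcases conj_of_rel4 h2 h3 hDf hDg (r := r) hr with ⟨M, c, e1, e2⟩ | ⟨M, c, e1, e2⟩
    · exact ⟨M, c, Or.inl ⟨e1, e2⟩⟩
    · exact ⟨M, c⁻¹, Or.inr ⟨e2, by rw [inv_inv]; exact e1⟩⟩
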